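/- Let α ∈ (0,∞), δ ∈ (-1,∞), σ ∈ [0,α] and let n ≥ 1 be an integer. Define the error ε_n(α,δ,x) := N(α,δ,x) − ∑_{k=0}^{n-1} ((-δ)_k / k!) γ(α+k,x)/x^{α+k} for x ∈ (0,∞), and set X_n(α,δ) := max(|(-δ)_n|/n!, |(1-δ)_{n-1}|/(n-1)!) if δ ≥ 0 and X_n(α,δ) := ((-δ)_{n-1}/(n-1)!) · ((α+n)/(δ+1) − (α+δ+1)/n) if δ ∈ (-1,0). Then sup_{x ∈ (0,∞)} x^σ |ε_n(α,δ,x)| ≤ X_n(α,δ) · σ^σ e^{-σ} / (α − σ + n), where σ^σ := 1 when σ = 0. -/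

import Mathlib

open MeasureTheory Real Filter

/-- The Pochhammer symbol `(a)_k = a (a+1) ⋯ (a+k-1)`, with `(a)_0 = 1`. -/
noncomputable def poch (a : ℝ) : ℕ → ℝ
  | 0 => 1
  | k + 1 => poch a k * (a + k)

/-- The lower incomplete Gamma function `γ(ν,x) = ∫₀ˣ s^(ν-1) e^(-s) ds`. -/
noncomputable def lincGamma (ν x : ℝ) : ℝ := ∫ s in (0:ℝ)..x, s ^ (ν - 1) * Real.exp (-s)

/-- The reparametrized Kummer function `N(α,δ,x) = ∫₀¹ t^(α-1) (1-t)^δ e^(-xt) dt`. -/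
noncomputable def NKummer (α δ x : ℝ) : ℝ :=
  ∫ t in (0:ℝ)..1, t ^ (α - 1) * (1 - t) ^ δ * Real.exp (-(x * t))

/-- Binomial coefficient of `(1-t)^δ`. -/
noncomputable def kc (δ : ℝ) (k : ℕ) : ℝ := poch (-δ) k / (k.factorial : ℝ)

/-- Taylor remainder of `(1-t)^δ`. -/
noncomputable def kR (δ : ℝ) (n : ℕ) (t : ℝ) : ℝ :=
  (1 - t) ^ δ - ∑ k ∈ Finset.range n, kc δ k * t ^ k

lemma poch_succ_left (a : ℝ) (n : ℕ) : poch a (n + 1) = a * poch (a + 1) n := by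
  induction n with
  | zero => simp [poch]
  | succ n ih =>
    rw [poch, ih, poch]; push_cast; ring

lemma kc_zero (δ : ℝ) : kc δ 0 = 1 := by simp [kc, poch]

lemma kc_succ (δ : ℝ) (n : ℕ) : kc δ (n + 1) * (n + 1) = kc δ n * (n - δ) := by
  have h : (n.factorial : ℝ) ≠ 0 := by positivity
  have h' : (n : ℝ) + 1 ≠ 0 := by positivity
  simp only [kc, poch, Nat.factorial_succ]
  push_cast
  field_simp
  ring

lemma kc_succ' (δ : ℝ) (n : ℕ) : kc δ (n + 1) * (n + 1) = -δ * kc (δ - 1) n := by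
  have h : (n.factorial : ℝ) ≠ 0 := by positivity
  have h' : (n : ℝ) + 1 ≠ 0 := by positivity
  simp only [kc, poch_succ_left, Nat.factorial_succ]
  push_cast
  rw [show -(δ - 1) = -δ + 1 by ring]
  field_simp

lemma kc_diff (δ : ℝ) (n : ℕ) : kc (δ + 1) (n + 1) = kc δ (n + 1) - kc δ n := by
  have h' : (n : ℝ) + 1 ≠ 0 := by positivity
  have h1 := kc_succ' (δ + 1) n
  have h2 := kc_succ δ n
  rw [show δ + 1 - 1 = δ by ring] at h1
  have : (kc (δ + 1) (n + 1) - (kc δ (n + 1) - kc δ n)) * ((n : ℝ) + 1) = 0 := by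
    linear_combination h1 - h2
  rcases mul_eq_zero.mp this with h | h
  · linarith
  · exact absurd h h'

lemma kc_sum (δ : ℝ) (m : ℕ) :
    ∑ k ∈ Finset.range (m + 1), kc δ k = poch (1 - δ) m / (m.factorial : ℝ) := by
  have e : ∀ m : ℕ, poch (1 - δ) m / (m.factorial : ℝ) = kc (δ - 1) m := by
    intro m; rw [kc, neg_sub]
  rw [e]
  induction m with
  | zero => simp [kc_zero]
  | succ m ih =>
    rw [Finset.sum_range_succ, ih]
    have := kc_diff (δ - 1) m
    rw [show δ - 1 + 1 = δ by ring] at this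
    linarith

lemma kR_succ (δ : ℝ) (n : ℕ) (t : ℝ) : kR δ (n + 1) t = kR δ n t - kc δ n * t ^ n := by
  simp only [kR, Finset.sum_range_succ]; ring

lemma kR_zero_right (δ : ℝ) (n : ℕ) : kR δ (n + 1) 0 = 0 := by
  simp [kR, Finset.sum_range_succ', kc_zero]

lemma hasDerivAt_one_sub (δ t : ℝ) (ht : t < 1) :
    HasDerivAt (fun t : ℝ => (1 - t) ^ δ) (-δ * (1 - t) ^ (δ - 1)) t := by
  have h : HasDerivAt (fun t : ℝ => 1 - t) (-1) t := by
    simpa using (hasDerivAt_id t).const_sub 1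
  have := h.rpow_const (p := δ) (Or.inl (by linarith : (1 - t) ≠ 0))
  convert! this using 1
  ring

lemma hasDerivAt_kR (δ : ℝ) (n : ℕ) (t : ℝ) (ht : t < 1) :
    HasDerivAt (kR δ (n + 1)) (-δ * kR (δ - 1) n t) t := by
  have h1 : HasDerivAt (fun t : ℝ => ∑ k ∈ Finset.range (n + 1), kc δ k * t ^ k)
      (∑ k ∈ Finset.range (n + 1), kc δ k * (k * t ^ (k - 1))) t := by
    apply HasDerivAt.fun_sum
    intro k _
    exact (hasDerivAt_pow k t).const_mul _
  have := (hasDerivAt_one_sub δ t ht).sub h1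
  convert! this using 1
  rw [Finset.sum_range_succ', kR, mul_sub, Finset.mul_sum]
  congr 1
  simp only [CharP.cast_eq_zero, zero_mul, mul_zero, add_zero, Nat.add_sub_cancel]
  apply Finset.sum_congr rfl
  intro k _
  have := kc_succ' δ k
  push_cast
  linear_combination (-t ^ k) * this

lemma nonneg_of_deriv (f f' : ℝ → ℝ) (h0 : f 0 = 0)
    (hd : ∀ t, 0 ≤ t → t < 1 → HasDerivAt f (f' t) t)
    (hn : ∀ t, 0 ≤ t → t < 1 → 0 ≤ f' t) (t : ℝ) (ht0 : 0 ≤ t) (ht : t < 1) : 0 ≤ f t := by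
  have hm : MonotoneOn f (Set.Ico 0 1) := by
    apply monotoneOn_of_deriv_nonneg (convex_Ico 0 1)
    · intro x hx
      exact (hd x hx.1 hx.2).continuousAt.continuousWithinAt
    · intro x hx
      have hx := interior_subset hx
      exact (hd x hx.1 hx.2).differentiableAt.differentiableWithinAt
    · intro x hx
      have hx := interior_subset hx
      rw [(hd x hx.1 hx.2).deriv]
      exact hn x hx.1 hx.2
  have := hm (Set.mem_Ico.mpr ⟨le_refl 0, by norm_num⟩) (Set.mem_Ico.mpr ⟨ht0, ht⟩) ht0
  rwa [h0] at this

lemma step_sign (n : ℕ) (δ s : ℝ) (h : ∀ k, n + 1 ≤ k → 0 ≤ s * kc δ k) :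
    ∀ k, n ≤ k → 0 ≤ (-δ * s) * kc (δ - 1) k := by
  intro k hk
  have h1 := h (k + 1) (by omega)
  have h2 := kc_succ' δ k
  have : (-δ * s) * kc (δ - 1) k = (s * kc δ (k + 1)) * (k + 1) := by
    linear_combination (-s) * h2
  rw [this]; positivity

lemma kR_sign (n : ℕ) : ∀ (δ s : ℝ), (∀ k, n ≤ k → 0 ≤ s * kc δ k) →
    ∀ t, 0 ≤ t → t < 1 → 0 ≤ s * kR δ n t := by
  induction n with
  | zero =>
    intro δ s h t ht0 ht
    have := h 0 le_rfl
    rw [kc_zero, mul_one] at this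
    simp only [kR, Finset.range_zero, Finset.sum_empty, sub_zero]
    have : 0 ≤ (1 - t) ^ δ := Real.rpow_nonneg (by linarith) _
    positivity
  | succ n ih =>
    intro δ s h
    apply nonneg_of_deriv (fun t => s * kR δ (n + 1) t) (fun t => (-δ * s) * kR (δ - 1) n t)
    · simp [kR_zero_right]
    · intro t _ ht
      convert! (hasDerivAt_kR δ n t ht).const_mul s using 1
      ring
    · exact ih (δ - 1) (-δ * s) (step_sign n δ s h)

/-- `t R' - n R` with index shifted by one. -/
noncomputable def kF (δ : ℝ) (n : ℕ) (t : ℝ) : ℝ :=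
  -δ * t * kR (δ - 1) n t - (n + 1) * kR δ (n + 1) t

lemma kF_sign (n : ℕ) : ∀ (δ s : ℝ), (∀ k, n + 1 ≤ k → 0 ≤ s * kc δ k) →
    ∀ t, 0 ≤ t → t < 1 → 0 ≤ s * kF δ n t := by
  induction n with
  | zero =>
    intro δ s h
    apply nonneg_of_deriv (fun t => s * kF δ 0 t)
      (fun t => s * (δ * (δ - 1) * t * (1 - t) ^ (δ - 2)))
    · simp [kF, kR_zero_right]
    · intro t _ ht
      have h1 := hasDerivAt_one_sub (δ - 1) t ht
      have h2 := hasDerivAt_one_sub δ t ht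
      have h3 := ((((hasDerivAt_id t).const_mul (-δ)).mul h1).sub (h2.sub_const 1)).const_mul s
      convert! h3 using 1
      · funext t; simp [kF, kR, kc_zero]
      · rw [show δ - 1 - 1 = δ - 2 by ring]; simp only [id]; ring
    · intro t ht0 ht
      have h2 := h 2 (by norm_num)
      have e := kc_succ δ 1
      have e1 := kc_succ δ 0
      rw [kc_zero] at e1
      norm_num at e e1
      have : 0 ≤ (1 - t) ^ (δ - 2) := Real.rpow_nonneg (by linarith) _
      have e3 : s * (δ * (δ - 1) * t * (1 - t) ^ (δ - 2)) =
        2 * (s * kc δ 2) * t * (1 - t) ^ (δ - 2) := by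
        rw [e1] at e
        linear_combination (-s * t * (1 - t) ^ (δ - 2)) * e
      rw [e3]; positivity
  | succ n ih =>
    intro δ s h
    apply nonneg_of_deriv (fun t => s * kF δ (n + 1) t) (fun t => (-δ * s) * kF (δ - 1) n t)
    · simp [kF, kR_zero_right]
    · intro t _ ht
      have h1 := hasDerivAt_kR (δ - 1) n t ht
      have h2 := hasDerivAt_kR δ (n + 1) t ht
      have h3 := ((((hasDerivAt_id t).const_mul (-δ)).mul h1).sub
        (h2.const_mul ((n : ℝ) + 1 + 1))).const_mul s
      convert! h3 using 1
      · funext t; simp [kF]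
      · simp only [id, kF]; ring
    · exact ih (δ - 1) (-δ * s) (step_sign (n + 1) δ s h)

lemma kR_bound_large (n : ℕ) : ∀ δ : ℝ, (n : ℝ) ≤ δ → ∀ t, 0 ≤ t → t < 1 →
    |kR δ n t| ≤ |kc δ n| * t ^ n := by
  induction n with
  | zero =>
    intro δ hδ t ht0 ht
    simp only [kR, Finset.range_zero, Finset.sum_empty, sub_zero, kc_zero, pow_zero]
    rw [abs_of_nonneg (Real.rpow_nonneg (by linarith) _)]
    simpa using Real.rpow_le_one (by linarith) (by linarith) (by simpa using hδ)
  | succ n ih =>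
    intro δ hδ t ht0 ht
    push_cast at hδ
    have hδ0 : 0 ≤ δ := by
      have : (0 : ℝ) ≤ n := Nat.cast_nonneg n
      linarith
    have ih' := ih (δ - 1) (by linarith)
    have hc : |kc δ (n + 1)| * ((n : ℝ) + 1) = δ * |kc (δ - 1) n| := by
      have := congrArg abs (kc_succ' δ n)
      rw [abs_mul, abs_mul, abs_neg, abs_of_nonneg hδ0] at this
      rwa [abs_of_nonneg (by positivity : (0 : ℝ) ≤ (n : ℝ) + 1)] at this
    have key : ∀ e : ℝ, |e| ≤ 1 → 0 ≤ |kc δ (n + 1)| * t ^ (n + 1) - e * kR δ (n + 1) t := by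
      intro e he
      refine nonneg_of_deriv (fun t => |kc δ (n + 1)| * t ^ (n + 1) - e * kR δ (n + 1) t)
        (fun t => δ * (|kc (δ - 1) n| * t ^ n + e * kR (δ - 1) n t)) ?_ ?_ ?_ t ht0 ht
      · simp [kR_zero_right]
      · intro t _ ht
        have h3 := ((hasDerivAt_pow (n + 1) t).const_mul (|kc δ (n + 1)|)).sub
          ((hasDerivAt_kR δ n t ht).const_mul e)
        convert! h3 using 1
        simp only [Nat.add_sub_cancel]
        push_cast
        linear_combination (-t ^ n) * hc
      · intro t ht0 ht
        apply mul_nonneg hδ0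
        have h1 := ih' t ht0 ht
        have h2 : |e * kR (δ - 1) n t| ≤ |kR (δ - 1) n t| := by
          rw [abs_mul]
          exact mul_le_of_le_one_left (abs_nonneg _) he
        have := neg_abs_le (e * kR (δ - 1) n t)
        linarith
    have k1 := key 1 (by norm_num)
    have k2 := key (-1) (by norm_num)
    rw [abs_le]
    constructor <;> linarith

lemma kc_same_sign (δ s : ℝ) (n : ℕ) (hδ : δ ≤ n) (h : 0 ≤ s * kc δ n) :
    ∀ k, n ≤ k → 0 ≤ s * kc δ k := by
  intro k hk
  induction k, hk using Nat.le_induction with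
  | base => exact h
  | succ k hk ih =>
    have e := kc_succ δ k
    have hk' : (n : ℝ) ≤ k := by exact_mod_cast hk
    have h1 : 0 ≤ (s * kc δ k) * (k - δ) := mul_nonneg ih (by linarith)
    have h2 : (s * kc δ (k + 1)) * ((k : ℝ) + 1) = (s * kc δ k) * (k - δ) := by
      linear_combination s * e
    rw [← h2] at h1
    exact nonneg_of_mul_nonneg_left h1 (by positivity)

lemma kR_bound_small (m : ℕ) (δ : ℝ) (hδ0 : 0 < δ) (hδ : δ ≤ (m : ℝ) + 1) (t : ℝ) (ht0 : 0 < t)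
    (ht : t < 1) :
    |kR δ (m + 1) t| ≤ |poch (1 - δ) m| / (m.factorial : ℝ) * t ^ (m + 1) := by
  obtain ⟨s, hs, hsc⟩ : ∃ s : ℝ, |s| = 1 ∧ 0 ≤ s * kc δ (m + 1) := by
    rcases le_total 0 (kc δ (m + 1)) with h | h
    · exact ⟨1, by simp, by simpa using h⟩
    · exact ⟨-1, by simp, by simpa using h⟩
  have hall := kc_same_sign δ s (m + 1) (by push_cast; exact hδ) hsc
  have hR := kR_sign (m + 1) δ s hall t ht0.le ht
  have hF := kF_sign m δ s hall
  have hcont : Continuous (kR δ (m + 1)) := by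
    unfold kR
    have : Continuous (fun t : ℝ => (1 - t) ^ δ) :=
      (continuous_const.sub continuous_id).rpow_const (fun _ => Or.inr hδ0.le)
    fun_prop
  have hm : MonotoneOn (fun t => s * kR δ (m + 1) t / t ^ (m + 1)) (Set.Ioc 0 1) := by
    have hd : ∀ x ∈ interior (Set.Ioc (0 : ℝ) 1),
        HasDerivAt (fun t => s * kR δ (m + 1) t / t ^ (m + 1))
          (s * kF δ m x * x ^ m / (x ^ (m + 1)) ^ 2) x := by
      intro x hx
      rw [interior_Ioc] at hx
      have hx0 : x ≠ 0 := hx.1.ne'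
      have h3 := ((hasDerivAt_kR δ m x hx.2).const_mul s).div (hasDerivAt_pow (m + 1) x)
        (pow_ne_zero _ hx0)
      convert! h3 using 1
      simp only [Nat.add_sub_cancel, kF]
      push_cast
      ring
    apply monotoneOn_of_deriv_nonneg (convex_Ioc 0 1)
    · intro x hx
      exact ((hcont.continuousAt.const_mul s).div (continuous_pow (m + 1)).continuousAt
        (pow_ne_zero _ hx.1.ne')).continuousWithinAt
    · intro x hx
      exact (hd x hx).differentiableAt.differentiableWithinAt
    · intro x hx
      rw [(hd x hx).deriv]
      rw [interior_Ioc] at hx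
      have := hF x hx.1.le hx.2
      have := hx.1
      positivity
  have h1 := hm (Set.mem_Ioc.mpr ⟨ht0, ht.le⟩) (Set.mem_Ioc.mpr ⟨one_pos, le_rfl⟩) ht.le
  have hR1 : kR δ (m + 1) 1 = - (poch (1 - δ) m / (m.factorial : ℝ)) := by
    rw [← kc_sum]
    simp [kR, Real.zero_rpow hδ0.ne']
  simp only [hR1, one_pow, div_one] at h1
  rw [div_le_iff₀ (by positivity)] at h1
  have h2 : |kR δ (m + 1) t| = s * kR δ (m + 1) t := by
    rw [← abs_of_nonneg hR, abs_mul, hs, one_mul]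
  rw [h2]
  refine h1.trans ?_
  gcongr
  refine (le_abs_self _).trans ?_
  rw [abs_mul, hs, one_mul, abs_neg, abs_div, abs_of_nonneg (by positivity : (0:ℝ) ≤ m.factorial)]

lemma kR_bound (δ : ℝ) (hδ : 0 ≤ δ) (n : ℕ) (hn : 1 ≤ n) (t : ℝ) (ht0 : 0 < t) (ht : t < 1) :
    |kR δ n t| ≤ max (|poch (-δ) n| / (n.factorial : ℝ))
              (|poch (1 - δ) (n - 1)| / ((n - 1).factorial : ℝ)) * t ^ n := by
  rcases le_or_gt (n : ℝ) δ with h | h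
  · refine (kR_bound_large n δ h t ht0.le ht).trans ?_
    gcongr
    refine le_trans (le_of_eq ?_) (le_max_left _ _)
    rw [kc, abs_div, abs_of_nonneg (by positivity : (0:ℝ) ≤ n.factorial)]
  · obtain ⟨m, rfl⟩ : ∃ m, n = m + 1 := ⟨n - 1, by omega⟩
    push_cast at h
    rcases hδ.eq_or_lt with h0 | h0
    · have : kR δ (m + 1) t = 0 := by
        subst h0
        have : ∀ k, kc 0 (k + 1) = 0 := by
          intro k; simp [kc, poch_succ_left]
        simp [kR, Finset.sum_range_succ', this, kc_zero]
      rw [this, abs_zero]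
      have : 0 ≤ |poch (-δ) (m + 1)| / ((m + 1).factorial : ℝ) := by positivity
      have := this.trans (le_max_left _ (|poch (1 - δ) (m + 1 - 1)| / ((m + 1 - 1).factorial : ℝ)))
      positivity
    · refine (kR_bound_small m δ h0 h.le t ht0 ht).trans ?_
      gcongr
      exact le_max_right _ _

lemma kR_ident (δ t : ℝ) (ht : t < 1) (n : ℕ) :
    t * kR δ n t - kR δ (n + 1) t = - kR (δ + 1) (n + 1) t := by
  induction n with
  | zero =>
    simp only [kR, Finset.sum_range_succ, Finset.range_zero, Finset.sum_empty, kc_zero]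
    rw [Real.rpow_add_one (by linarith : (1 - t) ≠ 0)]
    ring
  | succ n ih =>
    rw [kR_succ δ (n + 1), kR_succ (δ + 1) (n + 1), kc_diff]
    have := kR_succ δ n t
    linear_combination ih + t * this

lemma kc_nonneg (δ : ℝ) (hδ : δ < 0) (k : ℕ) : 0 ≤ kc δ k := by
  have := kc_same_sign δ 1 0 (by simpa using hδ.le) (by simp [kc_zero]) k (Nat.zero_le _)
  simpa using this

lemma kR_neg (δ : ℝ) (hδ : -1 < δ) (hδ0 : δ < 0) (n : ℕ) (t : ℝ) (ht0 : 0 ≤ t) (ht : t < 1) :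
    0 ≤ kR δ n t ∧ kR δ (n + 1) t ≤ t * kR δ n t := by
  constructor
  · have := kR_sign n δ 1 (fun k _ => by simpa using kc_nonneg δ hδ0 k) t ht0 ht
    simpa using this
  · have h1 : ∀ k, n + 1 ≤ k → 0 ≤ (-1) * kc (δ + 1) k := by
      intro k hk
      refine kc_same_sign (δ + 1) (-1) 1 (by norm_num; linarith) ?_ k (by omega)
      have := kc_succ (δ + 1) 0
      rw [kc_zero] at this
      norm_num at this
      rw [this]; linarith
    have := kR_sign (n + 1) (δ + 1) (-1) h1 t ht0 ht
    have := kR_ident δ t ht n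
    linarith

lemma beta_integrable (α δ : ℝ) (hα : 0 < α) (hδ : -1 < δ) :
    IntervalIntegrable (fun t : ℝ => t ^ (α - 1) * (1 - t) ^ δ) volume 0 1 := by
  have h := (Complex.betaIntegral_convergent (u := (α : ℂ)) (v := ((δ + 1 : ℝ) : ℂ))
    (by simpa using hα) (by simp only [Complex.ofReal_re]; linarith)).norm
  refine h.congr_uIoo ?_
  intro t ht
  rw [Set.uIoo_of_le zero_le_one] at ht
  have h1 : (0 : ℝ) < 1 - t := by linarith [ht.2]
  simp only [norm_mul]
  have e1 : ‖(t : ℂ) ^ ((α : ℂ) - 1)‖ = t ^ (α - 1) := by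
    rw [Complex.norm_cpow_eq_rpow_re_of_pos ht.1]; simp
  have e2 : ‖(1 - (t : ℂ)) ^ (((δ + 1 : ℝ) : ℂ) - 1)‖ = (1 - t) ^ δ := by
    rw [show (1 - (t : ℂ)) = ((1 - t : ℝ) : ℂ) by push_cast; rfl,
      Complex.norm_cpow_eq_rpow_re_of_pos h1]
    simp
  rw [e1, e2]

lemma lincGamma_eq (ν x : ℝ) (hx : 0 < x) :
    lincGamma ν x / x ^ ν = ∫ t in (0:ℝ)..1, t ^ (ν - 1) * Real.exp (-(x * t)) := by
  have h := intervalIntegral.integral_comp_mul_left (a := 0) (b := 1)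
    (fun s : ℝ => s ^ (ν - 1) * Real.exp (-s)) hx.ne'
  rw [mul_zero, mul_one, smul_eq_mul] at h
  change _ = x⁻¹ * lincGamma ν x at h
  have e : (∫ t in (0:ℝ)..1, (x * t) ^ (ν - 1) * Real.exp (-(x * t))) =
      x ^ (ν - 1) * ∫ t in (0:ℝ)..1, t ^ (ν - 1) * Real.exp (-(x * t)) := by
    rw [← intervalIntegral.integral_const_mul]
    apply intervalIntegral.integral_congr_Ioo_of_le zero_le_one
    intro t ht
    simp only
    rw [Real.mul_rpow hx.le ht.1.le]; ring
  rw [e, Real.rpow_sub_one hx.ne'] at h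
  have hp : 0 < x ^ ν := Real.rpow_pos_of_pos hx ν
  field_simp at h ⊢
  linarith

lemma error_eq (α δ x : ℝ) (hα : 0 < α) (hδ : -1 < δ) (hx : 0 < x) (n : ℕ) :
    NKummer α δ x - ∑ k ∈ Finset.range n,
          poch (-δ) k / (k.factorial : ℝ) * (lincGamma (α + k) x / x ^ (α + (k:ℝ))) =
    ∫ t in (0:ℝ)..1, t ^ (α - 1) * kR δ n t * Real.exp (-(x * t)) := by
  have hexp : ContinuousOn (fun t : ℝ => Real.exp (-(x * t))) (Set.uIcc 0 1) := by fun_prop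
  have hi1 : IntervalIntegrable (fun t : ℝ => t ^ (α - 1) * (1 - t) ^ δ * Real.exp (-(x * t)))
    volume 0 1 := (beta_integrable α δ hα hδ).mul_continuousOn hexp
  have hi2 : ∀ k : ℕ, IntervalIntegrable
      (fun t : ℝ => kc δ k * (t ^ (α + k - 1) * Real.exp (-(x * t)))) volume 0 1 := by
    intro k
    have hk : (0 : ℝ) ≤ k := Nat.cast_nonneg k
    exact ((intervalIntegral.intervalIntegrable_rpow' (by linarith)).mul_continuousOn
      hexp).const_mul _
  have e : ∑ k ∈ Finset.range n,
          poch (-δ) k / (k.factorial : ℝ) * (lincGamma (α + k) x / x ^ (α + (k:ℝ))) =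
      ∫ t in (0:ℝ)..1, ∑ k ∈ Finset.range n, kc δ k * (t ^ (α + k - 1) * Real.exp (-(x * t))) := by
    rw [intervalIntegral.integral_finsetSum (fun k _ => hi2 k)]
    apply Finset.sum_congr rfl
    intro k _
    rw [intervalIntegral.integral_const_mul, lincGamma_eq _ _ hx, kc]
  rw [e, NKummer, ← intervalIntegral.integral_sub hi1]
  · apply intervalIntegral.integral_congr_Ioo_of_le zero_le_one
    intro t ht
    simp only [kR]
    rw [mul_sub, sub_mul, Finset.mul_sum, Finset.sum_mul]
    congr 1
    apply Finset.sum_congr rfl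
    intro k _
    rw [show α + k - 1 = (α - 1) + k by ring, Real.rpow_add_natCast ht.1.ne']
    ring
  · have h := IntervalIntegrable.sum (Finset.range n) (fun k _ => hi2 k)
    convert! h using 1
    funext t
    simp

lemma pow_exp_bound (σ x t : ℝ) (hσ : 0 ≤ σ) (hx : 0 < x) (ht : 0 < t) :
    x ^ σ * Real.exp (-(x * t)) ≤ σ ^ σ * Real.exp (-σ) * t ^ (-σ) := by
  have key : (x * t) ^ σ * Real.exp (-(x * t)) ≤ σ ^ σ * Real.exp (-σ) := by
    rcases hσ.eq_or_lt with h | h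
    · subst h
      simp only [Real.rpow_zero, neg_zero, Real.exp_zero, one_mul]
      exact Real.exp_le_one_iff.mpr (by nlinarith [mul_pos hx ht])
    · have hy : 0 < x * t := mul_pos hx ht
      have h1 : (x * t) / σ ≤ Real.exp ((x * t) / σ - 1) := by
        linarith [Real.add_one_le_exp ((x * t) / σ - 1)]
      have h2 := Real.rpow_le_rpow (by positivity) h1 h.le
      rw [← Real.exp_mul, Real.div_rpow hy.le h.le, sub_mul, div_mul_cancel₀ _ h.ne', one_mul,
        div_le_iff₀ (by positivity), Real.exp_sub, ] at h2
      rw [Real.exp_neg, Real.exp_neg]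
      have : 0 < Real.exp (x * t) := Real.exp_pos _
      have : 0 < Real.exp σ := Real.exp_pos _
      rw [← div_eq_mul_inv, div_le_iff₀ (by positivity)]
      refine h2.trans (le_of_eq ?_)
      field_simp
  rw [Real.mul_rpow hx.le ht.le] at key
  rw [Real.rpow_neg ht.le]
  have : 0 < t ^ σ := Real.rpow_pos_of_pos ht _
  rw [← div_eq_mul_inv, le_div_iff₀ this]
  linarith

lemma kR_integral (δ : ℝ) (hδ : -1 < δ) (n : ℕ) :
    IntervalIntegrable (kR δ n) volume 0 1 ∧ ∫ t in (0:ℝ)..1, kR δ n t = kc δ n / (δ + 1) := by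
  have hd : δ + 1 ≠ 0 := by linarith
  induction n with
  | zero =>
    have h := beta_integrable 1 δ one_pos hδ
    have e : kR δ 0 = fun t : ℝ => (1 - t) ^ δ := by
      funext t; simp [kR]
    constructor
    · rw [e]; simpa using h
    · rw [e, intervalIntegral.integral_comp_sub_left (fun u : ℝ => u ^ δ) 1]
      rw [integral_rpow (Or.inl hδ), kc_zero]
      simp [Real.zero_rpow hd]
  | succ n ih =>
    have e : kR δ (n + 1) = fun t => kR δ n t - kc δ n * t ^ n := by
      funext t; exact kR_succ δ n t
    have hp : IntervalIntegrable (fun t : ℝ => kc δ n * t ^ n) volume 0 1 :=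
      (by fun_prop : Continuous (fun t : ℝ => kc δ n * t ^ n)).intervalIntegrable _ _
    rw [e]
    refine ⟨ih.1.sub hp, ?_⟩
    rw [intervalIntegral.integral_sub ih.1 hp, ih.2, intervalIntegral.integral_const_mul,
      integral_pow]
    have := kc_succ δ n
    have h1 : (n : ℝ) + 1 ≠ 0 := by positivity
    rw [div_sub' hd, div_eq_div_iff hd hd]
    simp only [one_pow, ne_eq, Nat.add_eq_zero_iff, one_ne_zero, and_false, not_false_eq_true,
      zero_pow, sub_zero]
    field_simp
    linear_combination (-1 : ℝ) * this

lemma main_reduction (α δ σ x : ℝ) (hα : 0 < α) (hδ : -1 < δ) (hσ : 0 ≤ σ) (hx : 0 < x)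
    (n : ℕ) (g : ℝ → ℝ) (hg : IntervalIntegrable g volume 0 1)
    (hb : ∀ t, 0 < t → t < 1 → t ^ (α - σ - 1) * |kR δ n t| ≤ g t) :
    x ^ σ * |NKummer α δ x - ∑ k ∈ Finset.range n,
          poch (-δ) k / (k.factorial : ℝ) * (lincGamma (α + k) x / x ^ (α + (k:ℝ)))| ≤
    (σ ^ σ * Real.exp (-σ)) * ∫ t in (0:ℝ)..1, g t := by
  rw [error_eq α δ x hα hδ hx n]
  have hxs : 0 < x ^ σ := Real.rpow_pos_of_pos hx _
  rw [← abs_of_pos hxs, ← abs_mul, ← intervalIntegral.integral_const_mul,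
    ← intervalIntegral.integral_const_mul, ← Real.norm_eq_abs]
  apply intervalIntegral.norm_integral_le_of_norm_le zero_le_one _ (hg.const_mul _)
  have hne : ∀ᵐ t : ℝ ∂volume, t ≠ 1 := by
    simp [ae_iff, measure_singleton]
  filter_upwards [hne] with t ht1 ht
  have ht0 : 0 < t := ht.1
  have hlt : t < 1 := lt_of_le_of_ne ht.2 ht1
  have hC : 0 ≤ σ ^ σ * Real.exp (-σ) := by positivity
  have ha : 0 < t ^ (α - 1) := Real.rpow_pos_of_pos ht0 _
  rw [Real.norm_eq_abs, abs_mul, abs_mul, abs_mul, abs_of_pos hxs, abs_of_pos ha,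
    abs_of_pos (Real.exp_pos _)]
  calc x ^ σ * (t ^ (α - 1) * |kR δ n t| * Real.exp (-(x * t)))
      = (x ^ σ * Real.exp (-(x * t))) * (t ^ (α - 1) * |kR δ n t|) := by ring
    _ ≤ (σ ^ σ * Real.exp (-σ) * t ^ (-σ)) * (t ^ (α - 1) * |kR δ n t|) := by
        exact mul_le_mul_of_nonneg_right (pow_exp_bound σ x t hσ hx ht0) (by positivity)
    _ = (σ ^ σ * Real.exp (-σ)) * (t ^ (α - σ - 1) * |kR δ n t|) := by
        rw [show α - σ - 1 = -σ + (α - 1) by ring, Real.rpow_add ht0]; ring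
    _ ≤ _ := by
        gcongr
        exact hb t ht0 hlt

lemma int_pow (β : ℝ) (hβ : 0 ≤ β) (n : ℕ) (hn : 1 ≤ n) :
    IntervalIntegrable (fun t : ℝ => t ^ (β - 1 + n)) volume 0 1 ∧
    ∫ t in (0:ℝ)..1, t ^ (β - 1 + n) = 1 / (β + n) := by
  have h1 : (1 : ℝ) ≤ n := by exact_mod_cast hn
  refine ⟨intervalIntegral.intervalIntegrable_rpow' (by linarith), ?_⟩
  rw [integral_rpow (Or.inl (by linarith)), show β - 1 + n + 1 = β + n by ring]
  rw [Real.zero_rpow (by linarith : β + n ≠ 0)]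
  simp

theorem kummer_gamma_error_weighted_sup_bound
    (α : ℝ) (hα : 0 < α) (δ : ℝ) (hδ : -1 < δ) (σ : ℝ) (hσ₁ : 0 ≤ σ) (hσ₂ : σ ≤ α)
    (n : ℕ) (hn : 1 ≤ n) :
    sSup ((fun x : ℝ => x ^ σ *
        |NKummer α δ x - ∑ k ∈ Finset.range n,
          poch (-δ) k / (k.factorial : ℝ) * (lincGamma (α + k) x / x ^ (α + (k:ℝ)))|)
      '' Set.Ioi 0)
      ≤ (if 0 ≤ δ then
            max (|poch (-δ) n| / (n.factorial : ℝ))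
              (|poch (1 - δ) (n - 1)| / ((n - 1).factorial : ℝ))
          else
            poch (-δ) (n - 1) / ((n - 1).factorial : ℝ) *
              ((α + n) / (δ + 1) - (α + δ + 1) / n)) *
        (σ ^ σ * Real.exp (-σ) / (α - σ + n)) := by
  have hn1 : (1 : ℝ) ≤ n := by exact_mod_cast hn
  have hβ : 0 ≤ α - σ := by linarith
  apply csSup_le (Set.Nonempty.image _ ⟨1, by simp⟩)
  rintro _ ⟨x, hx, rfl⟩
  have hx : 0 < x := hx
  simp only
  obtain ⟨hpi, hpe⟩ := int_pow (α - σ) hβ n hn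
  have hC : 0 ≤ σ ^ σ * Real.exp (-σ) := by positivity
  split_ifs with h0
  · set X := max (|poch (-δ) n| / (n.factorial : ℝ))
      (|poch (1 - δ) (n - 1)| / ((n - 1).factorial : ℝ)) with hX
    refine (main_reduction α δ σ x hα hδ hσ₁ hx n (fun t => X * t ^ (α - σ - 1 + n))
      (hpi.const_mul X) ?_).trans (le_of_eq ?_)
    · intro t ht0 ht
      have hp : 0 < t ^ (α - σ - 1) := Real.rpow_pos_of_pos ht0 _
      rw [Real.rpow_add_natCast ht0.ne']
      calc _ ≤ t ^ (α - σ - 1) * (X * t ^ n) := by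
            gcongr
            exact kR_bound δ h0 n hn t ht0 ht
        _ = _ := by ring
    · rw [intervalIntegral.integral_const_mul, hpe]; ring
  · push Not at h0
    obtain ⟨hRi, hRe⟩ := kR_integral δ hδ n
    refine (main_reduction α δ σ x hα hδ hσ₁ hx n
      (fun t => kR δ n t + kc δ n * t ^ (α - σ - 1 + n))
      (hRi.add (hpi.const_mul _)) ?_).trans ?_
    · intro t ht0 ht
      obtain ⟨hR0, hR1⟩ := kR_neg δ hδ h0 n t ht0.le ht
      rw [abs_of_nonneg hR0, Real.rpow_add_natCast ht0.ne']
      rw [kR_succ] at hR1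
      have hp : 0 < t ^ (α - σ - 1) := Real.rpow_pos_of_pos ht0 _
      have hp1 : t ^ (α - σ - 1) * t ≤ 1 := by
        rw [← Real.rpow_add_one ht0.ne', sub_add_cancel]
        exact Real.rpow_le_one ht0.le ht.le hβ
      calc t ^ (α - σ - 1) * kR δ n t
          ≤ t ^ (α - σ - 1) * (t * kR δ n t + kc δ n * t ^ n) := by
            gcongr; linarith
        _ = (t ^ (α - σ - 1) * t) * kR δ n t + kc δ n * (t ^ (α - σ - 1) * t ^ n) := by ring
        _ ≤ _ := by
            have := mul_le_mul_of_nonneg_right hp1 hR0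
            linarith
    · rw [intervalIntegral.integral_add hRi (hpi.const_mul _), hRe,
        intervalIntegral.integral_const_mul, hpe]
      obtain ⟨m, rfl⟩ : ∃ m, n = m + 1 := ⟨n - 1, by omega⟩
      have hc := kc_succ δ m
      have hp := kc_nonneg δ h0 m
      rw [Nat.add_sub_cancel]
      change _ ≤ kc δ m * _ * _
      push_cast at hn1 ⊢
      have hm : (0 : ℝ) ≤ m := Nat.cast_nonneg m
      have hm1 : (0 : ℝ) < (m : ℝ) + 1 := by positivity
      have hd : 0 < δ + 1 := by linarith
      have hB : 0 < α - σ + ((m : ℝ) + 1) := by positivity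
      have hc' : kc δ (m + 1) = kc δ m * (m - δ) / ((m : ℝ) + 1) := by
        rw [← hc]; field_simp
      have hfin : kc δ (m + 1) / (δ + 1) * (α - σ + ((m : ℝ) + 1)) + kc δ (m + 1) ≤
          kc δ m * ((α + (m + 1)) / (δ + 1) - (α + δ + 1) / (m + 1)) := by
        have e : kc δ m * ((α + (m + 1)) / (δ + 1) - (α + δ + 1) / (m + 1)) -
          (kc δ (m + 1) / (δ + 1) * (α - σ + ((m : ℝ) + 1)) + kc δ (m + 1)) =
          kc δ m * σ * (m - δ) / ((m + 1) * (δ + 1)) := by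
          rw [hc']; field_simp; ring
        have : 0 ≤ kc δ m * σ * (m - δ) / ((m + 1) * (δ + 1)) := by
          have : 0 ≤ (m : ℝ) - δ := by linarith
          positivity
        linarith
      calc σ ^ σ * Real.exp (-σ) *
            (kc δ (m + 1) / (δ + 1) + kc δ (m + 1) * (1 / (α - σ + ((m : ℝ) + 1))))
          = (kc δ (m + 1) / (δ + 1) * (α - σ + ((m : ℝ) + 1)) + kc δ (m + 1)) *
            (σ ^ σ * Real.exp (-σ) / (α - σ + ((m : ℝ) + 1))) := by
            field_simp
        _ ≤ _ := by gcongr
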